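/- Let C be a linear code of length n over R whose component codes satisfy 0 < dim_{F_q} C_i < n for each i = 1,2,3,4. Then C is an MDS code over R if and only if its Euclidean dual C^⊥ is an MDS code over R. -/

import Mathlib

open scoped BigOperators

/-- The ring `R = F_q + uF_q + vF_q + uvF_q ≅ F_q^4` (componentwise operations). -/
abbrev RR (F : Type*) := Fin 4 → F

/-- The pairwise orthogonal idempotents `γ_1, γ_2, γ_3, γ_4` of `R`,
realized as the standard idempotents of `F_q^4`. -/
def gam (F : Type*) [Field F] (i : Fin 4) : RR F := Pi.single i 1

/-- The `i`-th component code `C_i ⊆ F_q^n` of a code `C ⊆ R^n`. -/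
def compCode {F : Type*} [Field F] {n : ℕ} (C : Set (Fin n → RR F)) (i : Fin 4) :
    Set (Fin n → F) :=
  {x | ∃ c ∈ C, ∀ j, c j i = x j}

/-- Euclidean dual of a code over `R`. -/
def euclDualR {F : Type*} [Field F] {n : ℕ} (C : Set (Fin n → RR F)) :
    Set (Fin n → RR F) :=
  {s | ∀ t ∈ C, ∑ j, t j * s j = 0}

/-- `l`-Galois dual of a code over `R`; apply with `pl = p ^ l`
(the `l`-Galois inner product is `[t,s]_l = ∑ j, t j * (s j) ^ (p ^ l)`,
since `F^l(r) = r ^ (p ^ l)`). -/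
def galDualR {F : Type*} [Field F] {n : ℕ} (pl : ℕ) (C : Set (Fin n → RR F)) :
    Set (Fin n → RR F) :=
  {s | ∀ t ∈ C, ∑ j, t j * s j ^ pl = 0}

/-- `l`-Galois dual of a code over the field `F = F_q`; apply with `pl = p ^ l`. -/
def galDualF {F : Type*} [Field F] {ι : Type*} [Fintype ι] (pl : ℕ) (D : Set (ι → F)) :
    Set (ι → F) :=
  {x | ∀ c ∈ D, ∑ j, c j * x j ^ pl = 0}

/-- Lee weight of a vector over `R`: the sum of the Hamming weights of the
quadruples of `γ`-components of the coordinates. -/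
def leeWt {F : Type*} [Field F] [DecidableEq F] {n : ℕ} (c : Fin n → RR F) : ℕ :=
  ∑ j, hammingNorm (c j)

/-- Minimum Lee distance of a code over `R`. -/
noncomputable def dLee {F : Type*} [Field F] [DecidableEq F] {n : ℕ} (C : Set (Fin n → RR F)) : ℕ :=
  sInf (leeWt '' {c ∈ C | c ≠ 0})

/-- Minimum Hamming distance of a code over `F_q`. -/
noncomputable def dHam {F : Type*} [Field F] [DecidableEq F] {ι : Type*} [Fintype ι]
    (D : Set (ι → F)) : ℕ :=
  sInf (hammingNorm '' {x ∈ D | x ≠ 0})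

/-- The Gray map `ρ : R^n → F_q^{4n}`. -/
def gray {F : Type*} [Field F] {n : ℕ} (c : Fin n → RR F) : Fin n × Fin 4 → F :=
  fun ji => c ji.1 ji.2

/-- The code `C^α = {(α_1 c_1, …, α_n c_n) : c ∈ C}` over `R`. -/
def scaleCode {F : Type*} [Field F] {n : ℕ} (α : Fin n → RR F)
    (C : Set (Fin n → RR F)) : Set (Fin n → RR F) :=
  (fun c => fun j => α j * c j) '' C

/-- The code `C^a = {(a_1 c_1, …, a_n c_n) : c ∈ C}` over `F_q`. -/
def scaleCodeF {F : Type*} [Field F] {n : ℕ} (a : Fin n → F)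
    (D : Set (Fin n → F)) : Set (Fin n → F) :=
  (fun c => fun j => a j * c j) '' D

/-- `P_S`: the submatrix of `P` obtained by deleting the rows and columns
indexed by `S` (its determinant is `1` when `S` is everything, since the
empty matrix has determinant `1`). -/
def minorOff {F : Type*} [Field F] {m : ℕ} (P : Matrix (Fin m) (Fin m) F)
    (S : Finset (Fin m)) : Matrix {i : Fin m // i ∉ S} {i : Fin m // i ∉ S} F :=
  P.submatrix (fun a => (a : Fin m)) (fun a => (a : Fin m))

section Hamming

variable {F ι : Type*} [Field F] [DecidableEq F] [Fintype ι]

theorem hammingNorm_add_card_le {x : ι → F} {T : Finset ι} (h : ∀ j ∈ T, x j = 0) :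
    hammingNorm x + T.card ≤ Fintype.card ι := by
  classical
  have hd : Disjoint (Finset.univ.filter fun j => x j ≠ 0) T := by
    rw [Finset.disjoint_left]
    intro j hj hT
    exact (Finset.mem_filter.mp hj).2 (h j hT)
  rw [hammingNorm, ← Finset.card_union_of_disjoint hd]
  exact Finset.card_le_univ _

/-- Restriction of the codewords of `D` to the coordinates in `T`. -/
def restrictCoords (D : Submodule F (ι → F)) (T : Finset ι) : D →ₗ[F] (T → F) :=
  (LinearMap.funLeft F F (Subtype.val : T → ι)).comp D.subtype

omit [DecidableEq F] [Fintype ι] in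
theorem restrictCoords_apply (D : Submodule F (ι → F)) (T : Finset ι) (x : D) (j : T) :
    restrictCoords D T x j = (x : ι → F) j := rfl

/-- The Singleton bound. -/
theorem exists_hammingNorm_add_finrank_le (D : Submodule F (ι → F))
    (hD : 0 < Module.finrank F D) :
    ∃ x ∈ D, x ≠ 0 ∧ hammingNorm x + Module.finrank F D ≤ Fintype.card ι + 1 := by
  have hle : Module.finrank F D ≤ Fintype.card ι := by
    simpa using Submodule.finrank_le D
  obtain ⟨T, -, hT⟩ := Finset.exists_subset_card_eq
    (s := (Finset.univ : Finset ι)) (n := Module.finrank F D - 1)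
    (by rw [Finset.card_univ]; omega)
  have hker : LinearMap.ker (restrictCoords D T) ≠ ⊥ := by
    apply LinearMap.ker_ne_bot_of_finrank_lt
    rw [Module.finrank_fintype_fun_eq_card, Fintype.card_coe]
    omega
  obtain ⟨x, hx, hx0⟩ := Submodule.exists_mem_ne_zero_of_ne_bot hker
  refine ⟨x, x.2, by simpa using hx0, ?_⟩
  have := hammingNorm_add_card_le (x := (x : ι → F)) (T := T)
    fun j hj => congrFun (LinearMap.mem_ker.mp hx) ⟨j, hj⟩
  omega

/-- The weight condition saying that a code over a field meets the Singleton bound. -/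
def IsMDSCode (D : Submodule F (ι → F)) : Prop :=
  ∀ x ∈ D, x ≠ 0 → Fintype.card ι + 1 ≤ hammingNorm x + Module.finrank F D

/-- The Euclidean dual of a code over a field. -/
def dualCode [DecidableEq ι] (D : Submodule F (ι → F)) : Submodule F (ι → F) :=
  (D.map (dotProductEquiv F ι).toLinearMap).dualCoannihilator

omit [DecidableEq F] in
theorem mem_dualCode [DecidableEq ι] {D : Submodule F (ι → F)} {x : ι → F} :
    x ∈ dualCode D ↔ ∀ c ∈ D, c ⬝ᵥ x = 0 := by
  rw [dualCode, Submodule.mem_dualCoannihilator]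
  exact ⟨fun h c hc => h _ ⟨c, hc, rfl⟩, by rintro h _ ⟨c, hc, rfl⟩; exact h c hc⟩

omit [DecidableEq F] in
theorem finrank_add_finrank_dualCode [DecidableEq ι] (D : Submodule F (ι → F)) :
    Module.finrank F D + Module.finrank F (dualCode D) = Fintype.card ι := by
  have h := Subspace.finrank_add_finrank_dualCoannihilator_eq
    (D.map (dotProductEquiv F ι).toLinearMap)
  rw [LinearEquiv.finrank_map_eq, Module.finrank_fintype_fun_eq_card] at h
  exact h

omit [DecidableEq F] in
theorem dualCode_dualCode [DecidableEq ι] (D : Submodule F (ι → F)) :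
    dualCode (dualCode D) = D := by
  refine (Submodule.eq_of_le_of_finrank_eq (fun x hx => ?_) ?_).symm
  · rw [mem_dualCode]
    intro c hc
    rw [dotProduct_comm]
    exact mem_dualCode.mp hc x hx
  · have h₁ := finrank_add_finrank_dualCode D
    have h₂ := finrank_add_finrank_dualCode (dualCode D)
    omega

theorem IsMDSCode.dualCode [DecidableEq ι] {D : Submodule F (ι → F)} (h : IsMDSCode D) :
    IsMDSCode (dualCode D) := by
  intro x hx hx0
  by_contra! hlt
  have hdim := finrank_add_finrank_dualCode D
  obtain ⟨T, hsT, -, hT⟩ := Finset.exists_subsuperset_card_eq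
    (s := Finset.univ.filter fun j => x j ≠ 0) (t := Finset.univ)
    (n := Module.finrank F D) (Finset.subset_univ _)
    (by change hammingNorm x ≤ _; omega) (by rw [Finset.card_univ]; omega)
  have hinj : Function.Injective (restrictCoords D T) := by
    rw [injective_iff_map_eq_zero]
    intro c hc
    by_contra hc0
    have h₁ := h c c.2 (by simpa using hc0)
    have h₂ := hammingNorm_add_card_le (x := (c : ι → F)) (T := T)
      fun j hj => congrFun hc ⟨j, hj⟩
    omega
  have hsurj : Function.Surjective (restrictCoords D T) :=
    (LinearMap.injective_iff_surjective_of_finrank_eq_finrank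
      (by rw [Module.finrank_fintype_fun_eq_card, Fintype.card_coe, hT])).mp hinj
  obtain ⟨j, hj⟩ := Function.ne_iff.mp hx0
  have hjT : j ∈ T := hsT (by simpa using hj)
  obtain ⟨c, hc⟩ := hsurj (Pi.single ⟨j, hjT⟩ 1)
  have hdot := mem_dualCode.mp hx c c.2
  rw [dotProduct, Finset.sum_eq_single j] at hdot
  · have hcj := congrFun hc ⟨j, hjT⟩
    rw [restrictCoords_apply, Pi.single_eq_same] at hcj
    rw [hcj, one_mul] at hdot
    exact hj hdot
  · intro b _ hb
    by_cases hbT : b ∈ T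
    · have hcb := congrFun hc ⟨b, hbT⟩
      rw [restrictCoords_apply, Pi.single_eq_of_ne (by simpa using hb)] at hcb
      rw [hcb, zero_mul]
    · have : x b = 0 := by
        by_contra hxb
        exact hbT (hsT (by simpa using hxb))
      rw [this, mul_zero]
  · simp

theorem isMDSCode_dualCode_iff [DecidableEq ι] {D : Submodule F (ι → F)} :
    IsMDSCode (dualCode D) ↔ IsMDSCode D :=
  ⟨fun h => dualCode_dualCode D ▸ h.dualCode, IsMDSCode.dualCode⟩

end Hamming

section Components

variable {F : Type*} [Field F] {n : ℕ}

theorem leeWt_eq_sum_hammingNorm [DecidableEq F] (c : Fin n → RR F) :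
    leeWt c = ∑ i, hammingNorm fun j => c j i := by
  simp only [leeWt, hammingNorm, Finset.card_filter]
  exact Finset.sum_comm

/-- The component code as a linear code over `F`. -/
def compSubmodule (C : Submodule (RR F) (Fin n → RR F)) (i : Fin 4) :
    Submodule F (Fin n → F) where
  carrier := compCode (C : Set (Fin n → RR F)) i
  zero_mem' := ⟨0, C.zero_mem, fun _ => rfl⟩
  add_mem' := by
    rintro x y ⟨c, hc, hx⟩ ⟨d, hd, hy⟩
    exact ⟨c + d, C.add_mem hc hd, fun j => by simp [hx, hy]⟩
  smul_mem' := by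
    rintro a x ⟨c, hc, hx⟩
    exact ⟨(fun _ => a : RR F) • c, C.smul_mem _ hc, fun j => by simp [hx]⟩

theorem mem_iff_forall_mem_compSubmodule (C : Submodule (RR F) (Fin n → RR F))
    (c : Fin n → RR F) :
    c ∈ C ↔ ∀ i, (fun j => c j i) ∈ compSubmodule C i := by
  refine ⟨fun h i => ⟨c, h, fun _ => rfl⟩, fun h => ?_⟩
  choose d hd hdc using h
  have : c = ∑ i, gam F i • d i := by
    ext j i
    simp [gam, Finset.sum_apply, Pi.single_apply, hdc]
  rw [this]
  exact C.sum_mem fun i _ => C.smul_mem _ (hd i)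

theorem mem_euclDualR_iff_forall_mem_dualCode (C : Submodule (RR F) (Fin n → RR F))
    (s : Fin n → RR F) :
    s ∈ euclDualR (C : Set (Fin n → RR F)) ↔
      ∀ i, (fun j => s j i) ∈ dualCode (compSubmodule C i) := by
  constructor
  · intro h i
    rw [mem_dualCode]
    rintro x ⟨c, hc, hx⟩
    have h₁ := congrFun (h (gam F i • c) (C.smul_mem _ hc)) i
    simpa [gam, Finset.sum_apply, dotProduct, hx] using h₁
  · intro h t ht
    ext i
    have := mem_dualCode.mp (h i) (fun j => t j i)
      ((mem_iff_forall_mem_compSubmodule C t).mp ht i)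
    simpa [dotProduct, Finset.sum_apply] using this

variable {S : Set (Fin n → RR F)} {D : Fin 4 → Submodule F (Fin n → F)}

theorem card_eq_pow_sum_finrank [Fintype F]
    (hS : ∀ c, c ∈ S ↔ ∀ i, (fun j => c j i) ∈ D i) :
    Nat.card S = Fintype.card F ^ ∑ i, Module.finrank F (D i) := by
  let f : S ≃ ∀ i, D i :=
    { toFun := fun c i => ⟨fun j => c.1 j i, (hS c.1).mp c.2 i⟩
      invFun := fun x => ⟨fun j i => (x i).1 j, (hS _).mpr fun i => (x i).2⟩
      left_inv := fun _ => rfl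
      right_inv := fun _ => rfl }
  rw [Nat.card_congr f, Nat.card_pi, ← Finset.prod_pow_eq_pow_sum]
  refine Finset.prod_congr rfl fun i _ => ?_
  rw [Module.natCard_eq_pow_finrank (K := F), Nat.card_eq_fintype_card]

variable [DecidableEq F]

theorem dLee_le_hammingNorm (hS : ∀ c, c ∈ S ↔ ∀ i, (fun j => c j i) ∈ D i)
    {i : Fin 4} {x : Fin n → F} (hx : x ∈ D i) (hx0 : x ≠ 0) :
    dLee S ≤ hammingNorm x := by
  let c : Fin n → RR F := fun j => Pi.single i (x j)
  have hci : (fun j => c j i) = x := by ext j; simp [c]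
  have hci' : ∀ i' ≠ i, (fun j => c j i') = 0 := by
    intro i' hi'
    ext j
    simp [c, hi']
  have hwt : leeWt c = hammingNorm x := by
    rw [leeWt_eq_sum_hammingNorm, Finset.sum_eq_single i, hci]
    · intro i' _ hi'
      rw [hci' i' hi', hammingNorm_zero]
    · simp
  rw [← hwt]
  refine Nat.sInf_le ⟨c, ⟨(hS c).mpr fun i' => ?_, ?_⟩, rfl⟩
  · by_cases h : i' = i
    · subst h
      rwa [hci]
    · rw [hci' i' h]
      exact zero_mem _
  · rintro h
    apply hx0
    rw [← hci, h]
    rfl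

theorem exists_hammingNorm_le_dLee (hS : ∀ c, c ∈ S ↔ ∀ i, (fun j => c j i) ∈ D i)
    (hne : ∃ c ∈ S, c ≠ 0) :
    ∃ i, ∃ x ∈ D i, x ≠ 0 ∧ hammingNorm x ≤ dLee S := by
  obtain ⟨c₀, hc₀, hc₀'⟩ := hne
  obtain ⟨c, ⟨hc, hc0⟩, hcd⟩ :=
    Nat.sInf_mem (s := leeWt '' {c ∈ S | c ≠ 0}) ⟨_, c₀, ⟨hc₀, hc₀'⟩, rfl⟩
  obtain ⟨i, hi⟩ : ∃ i, (fun j => c j i) ≠ 0 := by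
    by_contra! h
    apply hc0
    ext j i
    exact congrFun (h i) j
  refine ⟨i, _, (hS c).mp hc i, hi, ?_⟩
  change _ ≤ sInf _
  rw [← hcd, leeWt_eq_sum_hammingNorm]
  exact Finset.single_le_sum (f := fun i => hammingNorm fun j => c j i)
    (fun _ _ => Nat.zero_le _) (Finset.mem_univ i)

/-- A code over `R` is MDS iff its components are MDS of the same dimension. -/
theorem four_mul_dLee_add_eq_iff (hS : ∀ c, c ∈ S ↔ ∀ i, (fun j => c j i) ∈ D i)
    (hD : ∀ i, 0 < Module.finrank F (D i)) :
    4 * dLee S + ∑ i, Module.finrank F (D i) = 4 * n + 4 ↔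
      ∃ m, ∀ i, Module.finrank F (D i) = m ∧ IsMDSCode (D i) := by
  have hb : ∀ i, dLee S + Module.finrank F (D i) ≤ n + 1 := by
    intro i
    obtain ⟨x, hx, hx0, hle⟩ := exists_hammingNorm_add_finrank_le (D i) (hD i)
    have := dLee_le_hammingNorm hS hx hx0
    rw [Fintype.card_fin] at hle
    omega
  rw [Fin.sum_univ_four]
  constructor
  · intro h
    have heq : ∀ i, dLee S + Module.finrank F (D i) = n + 1 := by
      have h0 := hb 0
      have h1 := hb 1
      have h2 := hb 2
      have h3 := hb 3
      intro i
      fin_cases i <;> simp only [Fin.zero_eta, Fin.mk_one, Fin.reduceFinMk] <;> omega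
    refine ⟨n + 1 - dLee S, fun i => ⟨by have := heq i; omega, fun x hx hx0 => ?_⟩⟩
    have h₁ := heq i
    have h₂ := dLee_le_hammingNorm hS hx hx0
    rw [Fintype.card_fin]
    omega
  · rintro ⟨m, hm⟩
    obtain ⟨i, x, hx, hx0, hle⟩ := exists_hammingNorm_le_dLee hS (by
      obtain ⟨x, hx, hx0, -⟩ := exists_hammingNorm_add_finrank_le (D 0) (hD 0)
      refine ⟨fun j => Pi.single 0 (x j), (hS _).mpr fun i => ?_, fun h => hx0 ?_⟩
      · by_cases hi : i = 0
        · subst hi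
          simpa using hx
        · simp only [Pi.single_eq_of_ne hi]
          exact zero_mem (D i)
      · ext j
        simpa using congrFun (congrFun h j) 0)
    have h₁ := (hm i).2 x hx hx0
    have h₂ := hb i
    rw [Fintype.card_fin] at h₁
    simp only [(hm _).1] at h₁ h₂ ⊢
    omega

end Components

/-- `C` (with `|C| = q^K`, `|C_i| = q^{k_i}`, `0 < k_i < n`,
`|C^⊥| = q^{K'}`) is MDS over `R` iff its Euclidean dual `C^⊥` is MDS over `R`. -/
theorem statement18 {p e n : ℕ} (hp : p.Prime) (he : 0 < e)
    (F : Type*) [Field F] [Fintype F] [DecidableEq F] (hcard : Fintype.card F = p ^ e)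
    (C : Submodule (RR F) (Fin n → RR F))
    (k : Fin 4 → ℕ)
    (hk : ∀ i, Nat.card (compCode (C : Set (Fin n → RR F)) i) = Fintype.card F ^ k i)
    (hk0 : ∀ i, 0 < k i) (hkn : ∀ i, k i < n)
    (K : ℕ) (hK : Nat.card C = Fintype.card F ^ K)
    (K' : ℕ) (hK' : Nat.card (euclDualR (C : Set (Fin n → RR F))) = Fintype.card F ^ K') :
    4 * dLee (C : Set (Fin n → RR F)) + K = 4 * n + 4 ↔
      4 * dLee (euclDualR (C : Set (Fin n → RR F))) + K' = 4 * n + 4 := by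
  have hC := mem_iff_forall_mem_compSubmodule C
  have hC' := mem_euclDualR_iff_forall_mem_dualCode C
  have hF : 1 < Fintype.card F := Fintype.one_lt_card
  have hKsum := Nat.pow_right_injective hF (hK.symm.trans (card_eq_pow_sum_finrank hC))
  have hKsum' := Nat.pow_right_injective hF (hK'.symm.trans (card_eq_pow_sum_finrank hC'))
  have hrank : ∀ i, Module.finrank F (compSubmodule C i) = k i := by
    intro i
    apply Nat.pow_right_injective hF
    have h := Module.natCard_eq_pow_finrank (K := F) (V := compSubmodule C i)
    rw [Nat.card_eq_fintype_card (α := F)] at h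
    exact h.symm.trans (hk i)
  have hdim : ∀ i, k i + Module.finrank F (dualCode (compSubmodule C i)) = n := by
    intro i
    rw [← hrank i, finrank_add_finrank_dualCode, Fintype.card_fin]
  rw [hKsum, hKsum', four_mul_dLee_add_eq_iff hC fun i => hrank i ▸ hk0 i,
    four_mul_dLee_add_eq_iff hC' fun i => by have := hdim i; have := hkn i; omega]
  simp only [isMDSCode_dualCode_iff, hrank]
  constructor
  · rintro ⟨m, hm⟩
    refine ⟨n - m, fun i => ⟨?_, (hm i).2⟩⟩
    have := hdim i
    have := (hm i).1
    omega
  · rintro ⟨m, hm⟩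
    refine ⟨n - m, fun i => ⟨?_, (hm i).2⟩⟩
    have := hdim i
    have := (hm i).1
    omega
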